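/- arXiv:1804.03935 — 3 statements merged into one kernel-verified Lean document; each statement's English description precedes it below -/
import Mathlib

section
/- Let X be a Banach space and T : ℓ₂ → X a compact linear operator, and set K = T(B_{ℓ₂}), where B_{ℓ₂} is the closed unit ball of the Hilbert sequence space ℓ₂ (K is compact). Then for every greedy sequence for K and every n ≥ 1, σ_{2n−1}(K)_X ≤ e·√2·Γ_n(X)·(∏_{k=0}^{n−1} d_k(K)_X)^{1/n}. -/
open scoped BigOperators NNReal ENNReal

noncomputable section

/-- The span of the first `n` elements of the sequence `f`. -/
def greedySpan {X : Type*} [NormedAddCommGroup X] [NormedSpace ℝ X]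
    (f : ℕ → X) (n : ℕ) : Submodule ℝ X :=
  Submodule.span ℝ (f '' Set.Iio n)

/-- The `n`-th greedy error `σ_n = dist(f_n, V_n)`. For `n = 0` this is `‖f 0‖`. -/
def greedyErr {X : Type*} [NormedAddCommGroup X] [NormedSpace ℝ X]
    (f : ℕ → X) (n : ℕ) : ℝ :=
  Metric.infDist (f n) (greedySpan f n : Set X)

/-- `f` is a greedy sequence for `K`: each `f n` lies in `K` and maximizes the distance to
`V_n = span{f_0,…,f_{n-1}}` among elements of `K` (for `n = 0`, `‖f 0‖ = max_{g∈K} ‖g‖`). -/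
def IsGreedySeq {X : Type*} [NormedAddCommGroup X] [NormedSpace ℝ X]
    (K : Set X) (f : ℕ → X) : Prop :=
  ∀ n : ℕ, f n ∈ K ∧ ∀ g ∈ K, Metric.infDist g (greedySpan f n : Set X) ≤ greedyErr f n

/-- Kolmogorov `n`-width of a set `K ⊆ X`. -/
def kolWidth {X : Type*} [NormedAddCommGroup X] [NormedSpace ℝ X]
    (K : Set X) : ℕ → ℝ
  | 0 => ⨆ g ∈ K, ‖g‖
  | (n+1) => ⨅ L : {L : Submodule ℝ X // Module.finrank ℝ L = n + 1},
      ⨆ g ∈ K, Metric.infDist g (L.1 : Set X)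

/-- Kolmogorov `n`-width of a bounded linear operator `T : E → X`. -/
def kolWidthOp {E X : Type*} [NormedAddCommGroup E] [NormedSpace ℝ E]
    [NormedAddCommGroup X] [NormedSpace ℝ X] (T : E →L[ℝ] X) : ℕ → ℝ
  | 0 => ‖T‖
  | (n+1) => ⨅ L : {L : Submodule ℝ X // Module.finrank ℝ L = n + 1},
      ⨆ x : {x : E // ‖x‖ ≤ 1}, Metric.infDist (T x.1) (L.1 : Set X)

/-- Gelfand `n`-width of a bounded linear operator `T : E → X`. -/
def gelfandWidthOp {E X : Type*} [NormedAddCommGroup E] [NormedSpace ℝ E]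
    [NormedAddCommGroup X] [NormedSpace ℝ X] (T : E →L[ℝ] X) : ℕ → ℝ
  | 0 => ‖T‖
  | (n+1) => ⨅ L : {L : Submodule ℝ E // IsClosed (L : Set E) ∧
        FiniteDimensional ℝ (E ⧸ L) ∧ Module.finrank ℝ (E ⧸ L) ≤ n + 1},
      ⨆ x : {x : E // x ∈ L.1 ∧ ‖x‖ ≤ 1}, ‖T x.1‖

/-- The `n`-th Grothendieck number of a bounded linear operator `T : X → Y`. -/
def grothOp {X Y : Type*} [NormedAddCommGroup X] [NormedSpace ℝ X]
    [NormedAddCommGroup Y] [NormedSpace ℝ Y] (T : X →L[ℝ] Y) (n : ℕ) : ℝ :=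
  ⨆ p : (Fin n → {x : X // ‖x‖ ≤ 1}) × (Fin n → {b : Y →L[ℝ] ℝ // ‖b‖ ≤ 1}),
    |Matrix.det (Matrix.of fun i j => (p.2 j).1 (T (p.1 i).1))| ^ ((1 : ℝ) / n)

/-- The `n`-th Grothendieck number of the Banach space `X`. -/
def groth (X : Type*) [NormedAddCommGroup X] [NormedSpace ℝ X] (n : ℕ) : ℝ :=
  grothOp (ContinuousLinearMap.id ℝ X) n

/-- Banach–Mazur distance between two normed spaces. -/
def bmDist (X Y : Type*) [NormedAddCommGroup X] [NormedSpace ℝ X]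
    [NormedAddCommGroup Y] [NormedSpace ℝ Y] : ℝ :=
  ⨅ T : X ≃L[ℝ] Y, ‖(T : X →L[ℝ] Y)‖ * ‖(T.symm : Y →L[ℝ] X)‖

/-- `γ_n(X)`: supremum of Banach–Mazur distances of `n`-dimensional subspaces of `X`
to `n`-dimensional Euclidean space. -/
def gammaBM (X : Type*) [NormedAddCommGroup X] [NormedSpace ℝ X] (n : ℕ) : ℝ :=
  ⨆ V : {V : Submodule ℝ X // Module.finrank ℝ V = n},
    bmDist V.1 (EuclideanSpace ℝ (Fin n))

/-- `T` satisfies the absolutely 2-summing inequality with constant `C`. -/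
def Summing2Bound {X Y : Type*} [NormedAddCommGroup X] [NormedSpace ℝ X]
    [NormedAddCommGroup Y] [NormedSpace ℝ Y] (T : X →L[ℝ] Y) (C : ℝ) : Prop :=
  ∀ (N : ℕ) (x : Fin N → X),
    (∑ i, ‖T (x i)‖ ^ 2) ^ ((1 : ℝ) / 2) ≤
      C * ⨆ b : {b : X →L[ℝ] ℝ // ‖b‖ ≤ 1}, (∑ i, (b.1 (x i)) ^ 2) ^ ((1 : ℝ) / 2)

/-- `T` is absolutely 2-summing. -/
def IsSumming2 {X Y : Type*} [NormedAddCommGroup X] [NormedSpace ℝ X]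
    [NormedAddCommGroup Y] [NormedSpace ℝ Y] (T : X →L[ℝ] Y) : Prop :=
  ∃ C : ℝ, 0 ≤ C ∧ Summing2Bound T C

/-- The 2-summing norm `‖T | B₂‖`. -/
def summing2Norm {X Y : Type*} [NormedAddCommGroup X] [NormedSpace ℝ X]
    [NormedAddCommGroup Y] [NormedSpace ℝ Y] (T : X →L[ℝ] Y) : ℝ :=
  sInf {C : ℝ | 0 ≤ C ∧ Summing2Bound T C}

end

theorem det_mul_eq_sum_prod_mul_det {ι κ : Type*} [Fintype ι] [DecidableEq ι] [Fintype κ]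
    [DecidableEq κ] (V : Matrix ι κ ℝ) (Z : Matrix κ ι ℝ) :
    (V * Z).det = ∑ φ : ι → κ, (∏ k, V k (φ k)) * (Z.submatrix φ id).det := by
  have h : V * Z = fun k => ∑ j, V k j • Z j := by
    ext k i
    simp [Matrix.mul_apply]
  have key := (Matrix.detRowAlternating (R := ℝ) (n := ι)).toMultilinearMap.map_sum
    (fun k j => V k j • Z j)
  rw [h]
  refine key.trans (Finset.sum_congr rfl fun φ _ => ?_)
  exact (Matrix.detRowAlternating (R := ℝ) (n := ι)).toMultilinearMap.map_smul_univ
    (fun k => V k (φ k)) (fun k => Z (φ k))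

/-- The Cauchy–Binet formula, with the sum running over all maps instead of all subsets. -/
theorem factorial_mul_det_mul_eq_sum {ι κ : Type*} [Fintype ι] [DecidableEq ι] [Fintype κ]
    [DecidableEq κ] (V : Matrix ι κ ℝ) (Z : Matrix κ ι ℝ) :
    ((Fintype.card ι).factorial : ℝ) * (V * Z).det =
      ∑ φ : ι → κ, (V.submatrix id φ).det * (Z.submatrix φ id).det := by
  have h (τ : Equiv.Perm ι) : (V * Z).det = ∑ φ : ι → κ,
      ((Equiv.Perm.sign τ : ℤ) : ℝ) * (∏ k, V k (φ (τ k))) * (Z.submatrix φ id).det := by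
    rw [det_mul_eq_sum_prod_mul_det]
    refine (Fintype.sum_equiv (Equiv.arrowCongr τ (Equiv.refl κ)).symm _ _ fun φ => ?_).symm
    have : (Z.submatrix (φ ∘ τ) id).det = ((Equiv.Perm.sign τ : ℤ) : ℝ) *
        (Z.submatrix φ id).det := Matrix.det_permute τ (Z.submatrix φ id)
    change _ = (∏ k, V k (φ (τ k))) * (Z.submatrix (φ ∘ τ) id).det
    rw [this]
    ring
  calc ((Fintype.card ι).factorial : ℝ) * (V * Z).det
      = ∑ τ : Equiv.Perm ι, (V * Z).det := by simp [Fintype.card_perm]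
    _ = ∑ τ : Equiv.Perm ι, ∑ φ : ι → κ,
      ((Equiv.Perm.sign τ : ℤ) : ℝ) * (∏ k, V k (φ (τ k))) * (Z.submatrix φ id).det :=
        Finset.sum_congr rfl fun τ _ => h τ
    _ = _ := by
      rw [Finset.sum_comm]
      refine Finset.sum_congr rfl fun φ _ => ?_
      rw [← Finset.sum_mul]
      congr 1
      rw [← Matrix.det_transpose, Matrix.det_apply']
      rfl

/-- A Gram matrix of unit vectors has determinant at most one. -/
theorem det_mul_transpose_le_one {ι κ : Type*} [Fintype ι] [DecidableEq ι] [Nonempty ι]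
    [Fintype κ] (V : Matrix ι κ ℝ) (hV : ∀ k, ∑ j, V k j ^ 2 = 1) :
    (V * V.transpose).det ≤ 1 := by
  have hpos : (V * V.transpose).PosSemidef := by
    simpa using Matrix.posSemidef_self_mul_conjTranspose V
  have htr : ∑ i, hpos.1.eigenvalues i = Fintype.card ι := by
    have h := hpos.1.trace_eq_sum_eigenvalues
    have h' : (V * V.transpose).trace = Fintype.card ι := by
      simp [Matrix.trace, Matrix.mul_apply, ← pow_two, hV]
    rw [h'] at h
    exact_mod_cast h.symm
  have hcard : (0 : ℝ) < Fintype.card ι := by exact_mod_cast Fintype.card_pos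
  have hamgm := Real.geom_mean_le_arith_mean Finset.univ (fun _ : ι => (1 : ℝ))
    hpos.1.eigenvalues (by simp) (by simpa using hcard) (fun i _ => hpos.eigenvalues_nonneg i)
  simp only [Real.rpow_one, one_mul, htr, Finset.sum_const, Finset.card_univ, nsmul_eq_mul,
    mul_one, div_self hcard.ne'] at hamgm
  have hdet : (V * V.transpose).det = ∏ i, hpos.1.eigenvalues i := by
    simpa using hpos.1.det_eq_prod_eigenvalues
  rw [hdet]
  by_contra! hlt
  exact absurd hamgm (not_le.2 (Real.one_lt_rpow hlt (by positivity)))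

/-- A determinant of a product of rectangular matrices is controlled by the minors of the
second factor when the rows of the first factor are unit vectors. -/
theorem abs_det_mul_le {ι κ : Type*} [Fintype ι] [DecidableEq ι] [Nonempty ι] [Fintype κ]
    [DecidableEq κ] (V : Matrix ι κ ℝ) (Z : Matrix κ ι ℝ) (hV : ∀ k, ∑ j, V k j ^ 2 = 1)
    {G : ℝ} (hG : 0 ≤ G) (hZ : ∀ φ : ι → κ, |(Z.submatrix φ id).det| ≤ G) :
    |(V * Z).det| ≤ √((Fintype.card κ : ℝ) ^ Fintype.card ι / (Fintype.card ι).factorial) * G := by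
  set N : ℝ := ((Fintype.card ι).factorial : ℝ)
  have hNpos : 0 < N := by positivity
  have hCS := Finset.sum_mul_sq_le_sq_mul_sq Finset.univ
    (fun φ : ι → κ => (V.submatrix id φ).det) (fun φ : ι → κ => (Z.submatrix φ id).det)
  rw [← factorial_mul_det_mul_eq_sum] at hCS
  have hgram : ∑ φ : ι → κ, (V.submatrix id φ).det ^ 2 ≤ N := by
    have h := factorial_mul_det_mul_eq_sum V V.transpose
    have h' : ∑ φ : ι → κ, (V.submatrix id φ).det ^ 2 = N * (V * V.transpose).det := by
      rw [h]
      refine Finset.sum_congr rfl fun φ _ => ?_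
      rw [pow_two, ← Matrix.det_transpose (V.transpose.submatrix φ id)]
      rfl
    rw [h']
    exact mul_le_of_le_one_right hNpos.le (det_mul_transpose_le_one V hV)
  have hminor : ∑ φ : ι → κ, (Z.submatrix φ id).det ^ 2 ≤
      (Fintype.card κ : ℝ) ^ Fintype.card ι * G ^ 2 := by
    refine (Finset.sum_le_sum fun φ _ => sq_le_sq' (neg_le_of_abs_le (hZ φ))
      (le_of_abs_le (hZ φ))).trans (le_of_eq ?_)
    simp
  have hsq : (V * Z).det ^ 2 ≤
      (Fintype.card κ : ℝ) ^ Fintype.card ι / N * G ^ 2 := by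
    have h := hCS.trans (mul_le_mul hgram hminor (by positivity) hNpos.le)
    rw [mul_pow] at h
    rw [div_mul_eq_mul_div, le_div_iff₀ hNpos]
    nlinarith
  rw [← Real.sqrt_sq hG, ← Real.sqrt_mul (by positivity)]
  exact Real.abs_le_sqrt hsq

theorem sqrt_two_mul_pow_div_factorial_le (n : ℕ) :
    √(((2 * n : ℕ) : ℝ) ^ n / n.factorial) ≤ (Real.exp 1 * √2) ^ n := by
  have h := Real.pow_div_factorial_le_exp (n : ℝ) n.cast_nonneg n
  refine Real.sqrt_le_iff.2 ⟨by positivity, ?_⟩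
  have h2 : ((Real.exp 1 * √2) ^ n) ^ 2 = 2 ^ n * (Real.exp n * Real.exp n) := by
    rw [← pow_mul, mul_comm n 2, pow_mul, mul_pow, Real.sq_sqrt zero_le_two, mul_pow, mul_comm,
      ← Real.exp_one_pow n]
    ring
  have h1 : 1 ≤ Real.exp n := Real.one_le_exp n.cast_nonneg
  rw [h2, Nat.cast_mul, mul_pow, mul_div_assoc]
  push_cast
  gcongr
  nlinarith

section Functionals

variable {X : Type*} [NormedAddCommGroup X] [NormedSpace ℝ X]

theorem exists_functional_eq_infDist (V : Submodule ℝ X) (x : X) :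
    ∃ b : X →L[ℝ] ℝ, ‖b‖ ≤ 1 ∧ (∀ g ∈ V, b g = 0) ∧ b x = Metric.infDist x (V : Set X) := by
  obtain ⟨g, hg, hgx⟩ := exists_dual_vector'' ℝ (Submodule.Quotient.mk x : X ⧸ V)
  have happly (y : X) : (g.comp V.mkQL) y = g (Submodule.Quotient.mk y) := by simp
  refine ⟨g.comp V.mkQL, ?_, fun y hy => ?_, ?_⟩
  · refine ContinuousLinearMap.opNorm_le_bound _ zero_le_one fun y => ?_
    rw [happly]
    exact (g.le_of_opNorm_le hg _).trans
      (mul_le_mul_of_nonneg_left (Submodule.Quotient.norm_mk_le V y) zero_le_one)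
  · rw [happly, (Submodule.Quotient.mk_eq_zero V).2 hy, map_zero]
  · rw [happly, hgx]
    exact QuotientAddGroup.norm_mk (S := V.toAddSubgroup) x

theorem abs_apply_le_infDist {V : Submodule ℝ X} {b : X →L[ℝ] ℝ} (hb : ‖b‖ ≤ 1)
    (hV : ∀ g ∈ V, b g = 0) (x : X) : |b x| ≤ Metric.infDist x (V : Set X) := by
  refine (Metric.le_infDist ⟨0, V.zero_mem⟩).2 fun y hy => ?_
  have h := b.le_of_opNorm_le hb (x - y)
  rwa [map_sub, hV y hy, sub_zero, one_mul, ← dist_eq_norm, Real.norm_eq_abs] at h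

theorem greedySpan_mono (f : ℕ → X) {m n : ℕ} (h : m ≤ n) : greedySpan f m ≤ greedySpan f n :=
  Submodule.span_mono (Set.image_mono (Set.Iio_subset_Iio h))

theorem IsGreedySeq.greedyErr_antitone {K : Set X} {f : ℕ → X} (hf : IsGreedySeq K f) :
    Antitone (greedyErr f) := fun m n h =>
  (Metric.infDist_le_infDist_of_subset (greedySpan_mono f h) ⟨0, Submodule.zero_mem _⟩).trans
    ((hf m).2 _ (hf n).1)

theorem kolWidth_nonneg (K : Set X) (k : ℕ) : 0 ≤ kolWidth K k := by
  cases k with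
  | zero => exact Real.iSup_nonneg fun g => Real.iSup_nonneg fun _ => norm_nonneg g
  | succ k =>
    exact Real.iInf_nonneg fun L => Real.iSup_nonneg fun g => Real.iSup_nonneg fun _ =>
      Metric.infDist_nonneg

theorem le_biSup_of_nonneg_of_le {α : Type*} {s : Set α} {u : α → ℝ} {R : ℝ}
    (h0 : ∀ x ∈ s, 0 ≤ u x) (hR : ∀ x ∈ s, u x ≤ R) {x : α} (hx : x ∈ s) :
    u x ≤ ⨆ y ∈ s, u y := by
  have hR0 : 0 ≤ R := (h0 x hx).trans (hR x hx)
  have hbdd : BddAbove (Set.range fun y => ⨆ _ : y ∈ s, u y) := by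
    refine ⟨R, ?_⟩
    rintro _ ⟨y, rfl⟩
    exact Real.iSup_le (fun hy => hR y hy) hR0
  refine le_ciSup_of_le hbdd x ?_
  rw [ciSup_pos hx]

/-- A nearly optimal subspace for the Kolmogorov width. -/
theorem exists_submodule_infDist_lt {K : Set X} {R : ℝ} (hK : ∀ g ∈ K, ‖g‖ ≤ R) {k : ℕ}
    (hk : ∃ L : Submodule ℝ X, Module.finrank ℝ L = k) {ε : ℝ} (hε : 0 < ε) :
    ∃ L : Submodule ℝ X, FiniteDimensional ℝ L ∧ Module.finrank ℝ L ≤ k ∧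
      ∀ g ∈ K, Metric.infDist g (L : Set X) < kolWidth K k + ε := by
  cases k with
  | zero =>
    refine ⟨⊥, inferInstance, by simp, fun g hg => ?_⟩
    have h : ‖g‖ ≤ kolWidth K 0 := le_biSup_of_nonneg_of_le (fun x _ => norm_nonneg x) hK hg
    simpa using h.trans_lt (lt_add_of_pos_right _ hε)
  | succ k =>
    obtain ⟨L₀, hL₀⟩ := hk
    have : Nonempty {L : Submodule ℝ X // Module.finrank ℝ L = k + 1} := ⟨⟨L₀, hL₀⟩⟩
    obtain ⟨L, hL⟩ := exists_lt_of_ciInf_lt (lt_add_of_pos_right (kolWidth K (k + 1)) hε)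
    refine ⟨L.1, FiniteDimensional.of_finrank_pos (by rw [L.2]; omega), L.2.le, fun g hg => ?_⟩
    refine lt_of_le_of_lt (le_biSup_of_nonneg_of_le (s := K)
      (u := fun g => Metric.infDist g (L.1 : Set X)) (R := R) (fun _ _ => Metric.infDist_nonneg)
      (fun x hx => ?_) hg) hL
    have h := Metric.infDist_le_dist_of_mem (x := x) L.1.zero_mem
    rw [dist_zero_right] at h
    exact h.trans (hK x hx)

theorem abs_det_le_groth_pow {n : ℕ} (hn : n ≠ 0) {z : Fin n → X} {b : Fin n → X →L[ℝ] ℝ}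
    (hz : ∀ i, ‖z i‖ ≤ 1) (hb : ∀ j, ‖b j‖ ≤ 1) :
    |(Matrix.of fun i j => b j (z i)).det| ≤ groth X n ^ n := by
  have hbound (p : (Fin n → {x : X // ‖x‖ ≤ 1}) × (Fin n → {b : X →L[ℝ] ℝ // ‖b‖ ≤ 1})) :
      |(Matrix.of fun i j => (p.2 j).1 (ContinuousLinearMap.id ℝ X (p.1 i).1)).det| ^
        ((1 : ℝ) / n) ≤ (n.factorial : ℝ) ^ ((1 : ℝ) / n) := by
    refine Real.rpow_le_rpow (abs_nonneg _) ?_ (by positivity)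
    have h := Matrix.det_le (A := Matrix.of fun i j =>
      (p.2 j).1 (ContinuousLinearMap.id ℝ X (p.1 i).1)) (abv := AbsoluteValue.abs) (x := 1)
      (fun i j => by
        have h := (p.2 j).1.le_of_opNorm_le (p.2 j).2 (p.1 i).1
        rw [one_mul] at h
        exact h.trans (p.1 i).2)
    simpa using h
  have h := le_ciSup (f := fun p : (Fin n → {x : X // ‖x‖ ≤ 1}) ×
      (Fin n → {b : X →L[ℝ] ℝ // ‖b‖ ≤ 1}) =>
      |(Matrix.of fun i j => (p.2 j).1 (ContinuousLinearMap.id ℝ X (p.1 i).1)).det| ^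
        ((1 : ℝ) / n)) ⟨_, Set.forall_mem_range.2 hbound⟩
      (fun i => ⟨z i, hz i⟩, fun j => ⟨b j, hb j⟩)
  have h' : (|(Matrix.of fun i j => b j (z i)).det| ^ ((1 : ℝ) / n)) ^ n ≤ groth X n ^ n :=
    pow_le_pow_left₀ (by positivity) h n
  rw [one_div, Real.rpow_inv_natCast_pow (abs_nonneg _) hn] at h'
  exact h'

theorem groth_nonneg (X : Type*) [NormedAddCommGroup X] [NormedSpace ℝ X] (n : ℕ) :
    0 ≤ groth X n :=
  Real.iSup_nonneg fun _ => Real.rpow_nonneg (abs_nonneg _) _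

/-- There is a unit combination of `N` functionals vanishing on a given subspace and on given
vectors, as long as these impose fewer than `N` conditions. -/
theorem exists_unit_combination_vanishing {N k : ℕ} (b : Fin N → X →L[ℝ] ℝ) (L : Submodule ℝ X)
    [FiniteDimensional ℝ L] (z : Fin k → X) (h : Module.finrank ℝ L + k < N) :
    ∃ v : Fin N → ℝ, ∑ j, v j ^ 2 = 1 ∧ (∀ g ∈ L, ∑ j, v j * b j g = 0) ∧
      ∀ i, ∑ j, v j * b j (z i) = 0 := by
  let e : X → (Fin N → ℝ) →ₗ[ℝ] ℝ := fun x => Fintype.linearCombination ℝ (fun j => b j x)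
  have he (x : X) (v : Fin N → ℝ) : e x v = ∑ j, v j * b j x := by
    simp [e, Fintype.linearCombination_apply]
  let B := Module.finBasis ℝ L
  let F : (Fin N → ℝ) →ₗ[ℝ] (Fin (Module.finrank ℝ L) → ℝ) × (Fin k → ℝ) :=
    (LinearMap.pi fun l => e (B l)).prod (LinearMap.pi fun i => e (z i))
  obtain ⟨u, hu, hu0⟩ := (Submodule.ne_bot_iff _).1
    (LinearMap.ker_ne_bot_of_finrank_lt (f := F) (by simpa using h))
  have hF := LinearMap.mem_ker.1 hu
  have hF1 (l) : e (B l) u = 0 := congrFun (congrArg Prod.fst hF) l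
  have hF2 (i) : e (z i) u = 0 := congrFun (congrArg Prod.snd hF) i
  have hL (g : X) (hg : g ∈ L) : e g u = 0 := by
    let φ : X →ₗ[ℝ] ℝ := ∑ j, u j • (b j : X →ₗ[ℝ] ℝ)
    have hφ (x : X) : φ x = e x u := by simp [φ, he]
    have h0 : φ.comp L.subtype = 0 := B.ext fun l => by simp [hφ, hF1]
    rw [← hφ]
    exact LinearMap.congr_fun h0 ⟨g, hg⟩
  have hpos : 0 < ∑ j, u j ^ 2 := by
    obtain ⟨j, hj⟩ := Function.ne_iff.1 hu0
    exact Finset.sum_pos' (fun _ _ => sq_nonneg _) ⟨j, Finset.mem_univ _, sq_pos_of_ne_zero hj⟩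
  set r := √(∑ j, u j ^ 2) with hr
  have hscale (x : X) (hx : e x u = 0) : ∑ j, (r⁻¹ • u) j * b j x = 0 := by
    rw [← he, map_smul, hx, smul_zero]
  refine ⟨r⁻¹ • u, ?_, fun g hg => hscale g (hL g hg), fun i => hscale _ (hF2 i)⟩
  simp only [Pi.smul_apply, smul_eq_mul, mul_pow, ← Finset.mul_sum, inv_pow]
  rw [hr, Real.sq_sqrt hpos.le, inv_mul_cancel₀ hpos.ne']

/-- Recursive choice of unit combinations and of unit vectors on which they form a triangular
matrix with a large diagonal. -/
theorem exists_triangular_system {N n : ℕ} (hN : 2 * n ≤ N) (b : Fin N → X →L[ℝ] ℝ)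
    {δ : ℕ → ℝ} {s : ℝ}
    (h : ∀ k < n, ∃ L : Submodule ℝ X, FiniteDimensional ℝ L ∧ Module.finrank ℝ L ≤ k ∧
      ∀ v : Fin N → ℝ, ∑ j, v j ^ 2 = 1 →
        ∃ y, s ≤ ∑ j, v j * b j y ∧ Metric.infDist y (L : Set X) < δ k) :
    ∀ m ≤ n, ∃ (v : ℕ → Fin N → ℝ) (z : ℕ → X), ∀ k < m, ∑ j, v k j ^ 2 = 1 ∧ ‖z k‖ ≤ 1 ∧
      s / δ k ≤ ∑ j, v k j * b j (z k) ∧ ∀ i < k, ∑ j, v k j * b j (z i) = 0 := by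
  intro m
  induction m with
  | zero => exact fun _ => ⟨0, 0, fun k hk => absurd hk (Nat.not_lt_zero k)⟩
  | succ m ih =>
    intro hm
    obtain ⟨v, z, hvz⟩ := ih (by omega)
    obtain ⟨L, hfin, hrank, hL⟩ := h m (by omega)
    obtain ⟨u, hu, huL, huz⟩ := exists_unit_combination_vanishing b L (fun i : Fin m => z i)
      (by omega)
    obtain ⟨y, hy, hdist⟩ := hL u hu
    obtain ⟨g, hg, hyg⟩ := (Metric.infDist_lt_iff ⟨0, L.zero_mem⟩).1 hdist
    have hδ : 0 < δ m := dist_nonneg.trans_lt hyg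
    refine ⟨Function.update v m u, Function.update z m ((δ m)⁻¹ • (y - g)), fun k hk => ?_⟩
    rcases Nat.lt_succ_iff_lt_or_eq.1 hk with hk | rfl
    · obtain ⟨h1, h2, h3, h4⟩ := hvz k hk
      rw [Function.update_of_ne hk.ne, Function.update_of_ne hk.ne]
      refine ⟨h1, h2, h3, fun i hi => ?_⟩
      rw [Function.update_of_ne (hi.trans hk).ne]
      exact h4 i hi
    · rw [Function.update_self, Function.update_self]
      refine ⟨hu, ?_, ?_, fun i hi => ?_⟩
      · rw [norm_smul, norm_inv, Real.norm_of_nonneg hδ.le, inv_mul_le_iff₀ hδ, mul_one,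
          ← dist_eq_norm]
        exact hyg.le
      · have : ∑ j, u j * b j ((δ k)⁻¹ • (y - g)) =
            (δ k)⁻¹ * (∑ j, u j * b j y - ∑ j, u j * b j g) := by
          rw [← Finset.sum_sub_distrib, Finset.mul_sum]
          refine Finset.sum_congr rfl fun j _ => ?_
          rw [map_smul, map_sub, smul_eq_mul]
          ring
        rw [this, huL g hg, sub_zero, div_eq_inv_mul]
        gcongr
      · rw [Function.update_of_ne hi.ne]
        exact huz ⟨i, hi⟩

/-- If every unit combination of `2n` norm-one functionals is at least `s` at points that are
`δ k`-close to `k`-dimensional subspaces, then `s` is bounded through the Grothendieck number. -/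
theorem pow_le_groth_pow_mul_prod {n : ℕ} (hn : n ≠ 0) (b : Fin (2 * n) → X →L[ℝ] ℝ)
    (hb : ∀ j, ‖b j‖ ≤ 1) {δ : ℕ → ℝ} (hδ : ∀ k, 0 < δ k) {s : ℝ} (hs : 0 ≤ s)
    (h : ∀ k < n, ∃ L : Submodule ℝ X, FiniteDimensional ℝ L ∧ Module.finrank ℝ L ≤ k ∧
      ∀ v : Fin (2 * n) → ℝ, ∑ j, v j ^ 2 = 1 →
        ∃ y, s ≤ ∑ j, v j * b j y ∧ Metric.infDist y (L : Set X) < δ k) :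
    s ^ n ≤ (Real.exp 1 * √2 * groth X n) ^ n * ∏ k ∈ Finset.range n, δ k := by
  obtain ⟨v, z, hvz⟩ := exists_triangular_system le_rfl b h n le_rfl
  have : Nonempty (Fin n) := ⟨⟨0, Nat.pos_of_ne_zero hn⟩⟩
  let V : Matrix (Fin n) (Fin (2 * n)) ℝ := Matrix.of fun k j => v k j
  let Z : Matrix (Fin (2 * n)) (Fin n) ℝ := Matrix.of fun j i => b j (z i)
  have hVZ (k i : Fin n) : (V * Z) k i = ∑ j, v k j * b j (z i) := by
    simp [V, Z, Matrix.mul_apply]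
  have hdet : (V * Z).det = ∏ k : Fin n, ∑ j, v k j * b j (z k) := by
    rw [Matrix.det_of_isUpperTriangular (M := V * Z) fun k i hik => by
      rw [hVZ]; exact (hvz k k.2).2.2.2 i hik]
    simp [hVZ]
  have hlow : s ^ n / ∏ k ∈ Finset.range n, δ k ≤ (V * Z).det := by
    rw [hdet, Finset.prod_range, ← Fin.prod_const, ← Finset.prod_div_distrib]
    exact Finset.prod_le_prod (fun k _ => div_nonneg hs (hδ k).le)
      fun k _ => (hvz k k.2).2.2.1
  have hup := abs_det_mul_le V Z (fun k => (hvz k k.2).1) (pow_nonneg (groth_nonneg X n) n)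
    fun φ => by
      rw [← Matrix.det_transpose]
      exact abs_det_le_groth_pow hn (z := fun i : Fin n => z i) (b := fun j => b (φ j))
        (fun i => (hvz i i.2).2.1) fun j => hb _
  rw [Fintype.card_fin, Fintype.card_fin] at hup
  have hprod : 0 < ∏ k ∈ Finset.range n, δ k := Finset.prod_pos fun k _ => hδ k
  rw [← div_le_iff₀ hprod, mul_pow]
  refine (hlow.trans (le_abs_self _)).trans (hup.trans ?_)
  exact mul_le_mul_of_nonneg_right (sqrt_two_mul_pow_div_factorial_le n)
    (pow_nonneg (groth_nonneg X n) n)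

end Functionals

theorem eq_smul_of_inner_eq {H : Type*} [NormedAddCommGroup H] [InnerProductSpace ℝ H]
    {x y : H} {σ : ℝ} (hσ : 0 < σ) (hx : ‖x‖ ≤ 1) (hy : ‖y‖ ≤ σ)
    (h : inner ℝ y x = σ) : ‖x‖ = 1 ∧ y = σ • x := by
  have hle : σ ≤ ‖y‖ * ‖x‖ := h ▸ real_inner_le_norm y x
  have hx1 : ‖x‖ = 1 := by
    refine le_antisymm hx ?_
    have : σ * 1 ≤ σ * ‖x‖ := by
      rw [mul_one]
      exact hle.trans (mul_le_mul_of_nonneg_right hy (norm_nonneg x))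
    exact le_of_mul_le_mul_left this hσ
  refine ⟨hx1, ?_⟩
  have hsq : ‖y - σ • x‖ ^ 2 ≤ 0 := by
    rw [norm_sub_sq_real, inner_smul_right, h, norm_smul, hx1, Real.norm_of_nonneg hσ.le]
    nlinarith [norm_nonneg y]
  have h0 : ‖y - σ • x‖ = 0 := by
    simpa using le_antisymm hsq (sq_nonneg _)
  exact sub_eq_zero.1 (norm_eq_zero.1 h0)

section HilbertBall

variable {H X : Type*} [NormedAddCommGroup H] [InnerProductSpace ℝ H] [CompleteSpace H]
  [NormedAddCommGroup X] [NormedSpace ℝ X]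

/-- The image of the closed unit ball of a Hilbert space under a bounded operator is closed. -/
theorem isClosed_image_hilbert_closedBall (T : H →L[ℝ] X) :
    IsClosed (T '' Metric.closedBall 0 1) := by
  let S : WeakDual ℝ H → WeakSpace ℝ X := fun φ =>
    toWeakSpace ℝ X (T ((InnerProductSpace.toDual ℝ H).symm (WeakDual.toStrongDual φ)))
  have hS : Continuous S := by
    refine WeakBilin.continuous_of_continuous_eval _ fun b => ?_
    have h : (fun φ : WeakDual ℝ H => (topDualPairing ℝ X).flip (S φ) b) =
        fun φ => φ ((InnerProductSpace.toDual ℝ H).symm (b.comp T)) := by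
      funext φ
      change (b.comp T) ((InnerProductSpace.toDual ℝ H).symm (WeakDual.toStrongDual φ)) =
        WeakDual.toStrongDual φ _
      rw [← InnerProductSpace.toDual_symm_apply (y := b.comp T), real_inner_comm,
        InnerProductSpace.toDual_symm_apply]
    exact h ▸ WeakDual.eval_continuous _
  have himage : T '' Metric.closedBall 0 1 = toWeakSpaceCLM ℝ X ⁻¹'
      (S '' (WeakDual.toStrongDual ⁻¹' Metric.closedBall (0 : StrongDual ℝ H) 1)) := by
    ext y
    constructor
    · rintro ⟨x, hx, rfl⟩
      refine ⟨StrongDual.toWeakDual (InnerProductSpace.toDual ℝ H x), ?_, ?_⟩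
      · simpa using hx
      · simp [S]
    · rintro ⟨φ, hφ, hy⟩
      refine ⟨(InnerProductSpace.toDual ℝ H).symm (WeakDual.toStrongDual φ), ?_, ?_⟩
      · simpa using hφ
      · exact (toWeakSpace ℝ X).injective hy
  rw [himage]
  exact (((WeakDual.isCompact_closedBall (𝕜 := ℝ) (0 : StrongDual ℝ H) 1).image
    hS).isClosed).preimage (toWeakSpaceCLM ℝ X).continuous

/-- A nondegenerate greedy sequence in the image of a Hilbert ball comes from an orthonormal
system, which is biorthogonal up to the greedy errors to functionals of norm at most one. -/
theorem IsGreedySeq.exists_orthonormal {T : H →L[ℝ] X} {f : ℕ → X}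
    (hf : IsGreedySeq (T '' Metric.closedBall 0 1) f) {N : ℕ}
    (hpos : ∀ j : Fin N, 0 < greedyErr f j) :
    ∃ (x : Fin N → H) (b : Fin N → X →L[ℝ] ℝ), Orthonormal ℝ x ∧ (∀ j, ‖b j‖ ≤ 1) ∧
      ∀ j i, b j (T (x i)) = if j = i then greedyErr f j else 0 := by
  choose x hx hxf using fun j : Fin N => (hf j).1
  choose b hb hbV hbf using fun j : Fin N => exists_functional_eq_infDist (greedySpan f j) (f j)
  let y : Fin N → H := fun j => (InnerProductSpace.toDual ℝ H).symm ((b j).comp T)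
  have hy (j : Fin N) (u : H) : inner ℝ (y j) u = b j (T u) :=
    InnerProductSpace.toDual_symm_apply
  have hnorm (j : Fin N) : ‖y j‖ ≤ greedyErr f j := by
    rw [LinearIsometryEquiv.norm_map]
    refine ContinuousLinearMap.opNorm_le_of_unit_norm (hpos j).le fun u hu => ?_
    exact (abs_apply_le_infDist (hb j) (hbV j) (T u)).trans
      ((hf j).2 _ ⟨u, by simp [hu], rfl⟩)
  have hkey (j : Fin N) : ‖x j‖ = 1 ∧ y j = greedyErr f j • x j :=
    eq_smul_of_inner_eq (hpos j) (by simpa using hx j) (hnorm j) (by rw [hy, hxf, hbf]; rfl)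
  have hlt {i j : Fin N} (hij : i < j) : inner ℝ (x j) (x i) = 0 := by
    have h : inner ℝ (y j) (x i) = 0 := by
      rw [hy, hxf]
      exact hbV j _ (Submodule.subset_span ⟨i, hij, rfl⟩)
    rw [(hkey j).2, real_inner_smul_left] at h
    exact (mul_eq_zero.1 h).resolve_left (hpos j).ne'
  have hx_on : Orthonormal ℝ x := by
    refine ⟨fun j => (hkey j).1, fun i j hij => ?_⟩
    rcases lt_or_gt_of_ne hij with h | h
    · rw [real_inner_comm]
      exact hlt h
    · exact hlt h
  refine ⟨x, b, hx_on, hb, fun j i => ?_⟩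
  rw [← hy, (hkey j).2, real_inner_smul_left, orthonormal_iff_ite.1 hx_on]
  simp

theorem IsGreedySeq.greedyErr_pow_le {T : H →L[ℝ] X} {f : ℕ → X}
    (hf : IsGreedySeq (T '' Metric.closedBall 0 1) f) {n : ℕ} (hn : n ≠ 0)
    (hpos : 0 < greedyErr f (2 * n - 1)) {ε : ℝ} (hε : 0 < ε) :
    greedyErr f (2 * n - 1) ^ n ≤ (Real.exp 1 * √2 * groth X n) ^ n *
      ∏ k ∈ Finset.range n, (kolWidth (T '' Metric.closedBall 0 1) k + ε) := by
  have hle (j : Fin (2 * n)) : greedyErr f (2 * n - 1) ≤ greedyErr f j :=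
    hf.greedyErr_antitone (by omega)
  obtain ⟨x, b, hx, hb, hbx⟩ :=
    hf.exists_orthonormal (N := 2 * n) fun j => hpos.trans_le (hle j)
  have hTx : LinearIndependent ℝ fun i => T (x i) := by
    refine Fintype.linearIndependent_iff.2 fun c hc j => ?_
    have h := congrArg (b j) hc
    rw [map_sum, map_zero] at h
    simp only [map_smul, hbx, smul_eq_mul, mul_ite, mul_zero, Finset.sum_ite_eq,
      Finset.mem_univ, if_true] at h
    exact (mul_eq_zero.1 h).resolve_right (hpos.trans_le (hle j)).ne'
  have hbound : ∀ g ∈ T '' Metric.closedBall 0 1, ‖g‖ ≤ ‖T‖ := by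
    rintro _ ⟨u, hu, rfl⟩
    exact T.unit_le_opNorm u (by simpa using hu)
  refine pow_le_groth_pow_mul_prod hn b hb
    (fun k => add_pos_of_nonneg_of_pos (kolWidth_nonneg _ k) hε) hpos.le fun k hk => ?_
  have hsub : ∃ L : Submodule ℝ X, Module.finrank ℝ L = k := by
    have hinj : Function.Injective fun i : Fin k => (⟨i, by omega⟩ : Fin (2 * n)) :=
      fun i j hij => Fin.ext (Fin.mk.inj hij)
    exact ⟨_, (finrank_span_eq_card (hTx.comp _ hinj)).trans (Fintype.card_fin k)⟩
  obtain ⟨L, hfin, hrank, hL⟩ := exists_submodule_infDist_lt hbound hsub hε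
  refine ⟨L, hfin, hrank, fun v hv => ⟨T (∑ i, v i • x i), ?_, hL _ ⟨_, ?_, rfl⟩⟩⟩
  · have hval (j : Fin (2 * n)) : b j (T (∑ i, v i • x i)) = v j * greedyErr f j := by
      simp [map_sum, hbx]
    calc greedyErr f (2 * n - 1) = ∑ j, v j ^ 2 * greedyErr f (2 * n - 1) := by
          rw [← Finset.sum_mul, hv, one_mul]
      _ ≤ ∑ j, v j * b j (T (∑ i, v i • x i)) := Finset.sum_le_sum fun j _ => by
          rw [hval, ← mul_assoc, ← pow_two]
          exact mul_le_mul_of_nonneg_left (hle j) (sq_nonneg _)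
  · have hsq : ‖∑ i, v i • x i‖ ^ 2 = 1 := by
      rw [← real_inner_self_eq_norm_sq, hx.inner_sum, ← hv]
      simp [pow_two]
    rw [mem_closedBall_zero_iff]
    exact ((pow_eq_one_iff_of_nonneg (norm_nonneg _) two_ne_zero).1 hsq).le

theorem IsGreedySeq.greedyErr_le {T : H →L[ℝ] X} {f : ℕ → X}
    (hf : IsGreedySeq (T '' Metric.closedBall 0 1) f) {n : ℕ} (hn : n ≠ 0) :
    greedyErr f (2 * n - 1) ≤ Real.exp 1 * √2 * groth X n *
      (∏ k ∈ Finset.range n, kolWidth (T '' Metric.closedBall 0 1) k) ^ ((1 : ℝ) / n) := by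
  set K := T '' Metric.closedBall 0 1
  have hprod : 0 ≤ ∏ k ∈ Finset.range n, kolWidth K k :=
    Finset.prod_nonneg fun k _ => kolWidth_nonneg K k
  have hC : 0 ≤ Real.exp 1 * √2 * groth X n :=
    mul_nonneg (by positivity) (groth_nonneg X n)
  have hrhs := mul_nonneg hC (Real.rpow_nonneg hprod ((1 : ℝ) / n))
  rcases (Metric.infDist_nonneg : 0 ≤ greedyErr f (2 * n - 1)).eq_or_lt with h0 | hpos
  · exact h0.symm.le.trans hrhs
  refine le_of_pow_le_pow_left₀ hn hrhs ?_
  rw [mul_pow, one_div, Real.rpow_inv_natCast_pow hprod hn]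
  have hlim : Filter.Tendsto (fun ε : ℝ => (Real.exp 1 * √2 * groth X n) ^ n *
      ∏ k ∈ Finset.range n, (kolWidth K k + ε)) (nhdsWithin 0 (Set.Ioi 0))
      (nhds ((Real.exp 1 * √2 * groth X n) ^ n * ∏ k ∈ Finset.range n, (kolWidth K k + 0))) :=
    (Continuous.tendsto (by fun_prop) 0).mono_left nhdsWithin_le_nhds
  simp only [add_zero] at hlim
  exact ge_of_tendsto hlim
    (eventually_nhdsWithin_of_forall fun ε hε => hf.greedyErr_pow_le hn hpos hε)

end HilbertBall

theorem greedy_bound_for_hilbert_ball_image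
    {X : Type*} [NormedAddCommGroup X] [NormedSpace ℝ X] [CompleteSpace X]
    (T : lp (fun _ : ℕ => ℝ) 2 →L[ℝ] X) (hT : IsCompactOperator T)
    (K : Set X) (hK : K = T '' Metric.closedBall 0 1) :
    IsCompact K ∧
      ∀ f : ℕ → X, IsGreedySeq K f → ∀ n : ℕ, 1 ≤ n →
        greedyErr f (2 * n - 1) ≤
          Real.exp 1 * Real.sqrt 2 * groth X n *
            (∏ k ∈ Finset.range n, kolWidth K k) ^ ((1 : ℝ) / n) := by
  subst hK
  refine ⟨?_, fun f hf n hn => hf.greedyErr_le (Nat.one_le_iff_ne_zero.1 hn)⟩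
  rw [← (isClosed_image_hilbert_closedBall T).closure_eq]
  exact hT.isCompact_closure_image_closedBall (f := (T : lp (fun _ : ℕ => ℝ) 2 →ₗ[ℝ] X)) 1
end

section
/- Let X and Y be Banach spaces and T : X → Y a bounded linear operator. Then for all n ≥ 1, (∏_{k=0}^{n−1} d_k(T))^{1/n} ≤ Γ_n(T) and (∏_{k=0}^{n−1} d^k(T))^{1/n} ≤ Γ_n(T). -/
open scoped BigOperators NNReal ENNReal

/-- A finite sequence with a prescribed property of each term and a prescribed relation between
earlier and later terms exists as soon as every shorter one can be extended. -/
theorem exists_seq_of_extend {α : Type*} [Nonempty α] (Q : ℕ → α → Prop) (R : α → α → Prop)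
    (n : ℕ)
    (h : ∀ k < n, ∀ f : ℕ → α, (∀ i < k, Q i (f i) ∧ ∀ j < i, R (f j) (f i)) →
      ∃ a, Q k a ∧ ∀ i < k, R (f i) a) :
    ∃ f : ℕ → α, ∀ i < n, Q i (f i) ∧ ∀ j < i, R (f j) (f i) := by
  induction n with
  | zero => exact ⟨fun _ => Classical.arbitrary α, by simp⟩
  | succ n ih =>
    obtain ⟨f, hf⟩ := ih fun k hk => h k (hk.trans n.lt_succ_self)
    obtain ⟨a, ha, hR⟩ := h n n.lt_succ_self f hf
    refine ⟨Function.update f n a, fun i hi => ?_⟩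
    rcases (Nat.lt_succ_iff_lt_or_eq.1 hi) with hi | rfl
    · rw [Function.update_of_ne hi.ne]
      refine ⟨(hf i hi).1, fun j hj => ?_⟩
      rw [Function.update_of_ne (hj.trans hi).ne]
      exact (hf i hi).2 j hj
    · rw [Function.update_self]
      refine ⟨ha, fun j hj => ?_⟩
      rw [Function.update_of_ne hj.ne]
      exact hR j hj

section Widths

variable {X Y : Type*} [NormedAddCommGroup X] [NormedSpace ℝ X]
  [NormedAddCommGroup Y] [NormedSpace ℝ Y]

/-- Every vector has a functional of norm at most one that vanishes on a given subspace and
takes the distance to that subspace as its value. -/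
theorem exists_dual_eq_infDist (L : Submodule ℝ Y) (y : Y) :
    ∃ b : Y →L[ℝ] ℝ, ‖b‖ ≤ 1 ∧ (∀ z ∈ L, b z = 0) ∧ b y = Metric.infDist y (L : Set Y) := by
  have hmk (z : Y) : ‖L.mkQ z‖ = Metric.infDist z (L : Set Y) :=
    QuotientAddGroup.norm_mk (S := L.toAddSubgroup) z
  obtain ⟨g, hg, hgy⟩ := exists_dual_vector'' ℝ (L.mkQ y)
  refine ⟨LinearMap.mkContinuous ((g : (Y ⧸ L) →ₗ[ℝ] ℝ) ∘ₗ L.mkQ) 1 fun z => ?_,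
    LinearMap.mkContinuous_norm_le _ zero_le_one _, fun z hz => ?_, ?_⟩
  · refine (g.le_of_opNorm_le hg (L.mkQ z)).trans ?_
    rw [hmk]
    gcongr
    simpa using Metric.infDist_le_dist_of_mem (x := z) L.zero_mem
  · simp [(Submodule.Quotient.mk_eq_zero L).2 hz]
  · simpa [← hmk] using hgy

theorem infDist_map_le_opNorm (T : X →L[ℝ] Y) (L : Submodule ℝ Y) {x : X} (hx : ‖x‖ ≤ 1) :
    Metric.infDist (T x) (L : Set Y) ≤ ‖T‖ := by
  refine (Metric.infDist_le_dist_of_mem L.zero_mem).trans ?_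
  simpa using T.le_of_opNorm_le_of_le le_rfl hx

theorem kolWidthOp_nonneg (T : X →L[ℝ] Y) (n : ℕ) : 0 ≤ kolWidthOp T n := by
  cases n with
  | zero => exact norm_nonneg T
  | succ n => exact Real.iInf_nonneg fun L => Real.iSup_nonneg fun x => Metric.infDist_nonneg

theorem gelfandWidthOp_nonneg (T : X →L[ℝ] Y) (n : ℕ) : 0 ≤ gelfandWidthOp T n := by
  cases n with
  | zero => exact norm_nonneg T
  | succ n => exact Real.iInf_nonneg fun L => Real.iSup_nonneg fun x => norm_nonneg _

/-- Below the Kolmogorov width, some point of the unit ball has its image far from a given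
subspace of the corresponding dimension. -/
theorem exists_lt_infDist_of_lt_kolWidthOp (T : X →L[ℝ] Y) {n : ℕ} {c : ℝ}
    (hc : c < kolWidthOp T n) (L : Submodule ℝ Y) [FiniteDimensional ℝ L]
    (hL : Module.finrank ℝ L = n) :
    ∃ x : X, ‖x‖ ≤ 1 ∧ c < Metric.infDist (T x) (L : Set Y) := by
  cases n with
  | zero =>
    obtain ⟨x, hx, hcx⟩ := T.exists_lt_apply_of_lt_opNorm hc
    obtain rfl := Submodule.finrank_eq_zero.1 hL
    exact ⟨x, hx.le, by simpa using hcx⟩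
  | succ n =>
    have hlt : c < ⨆ x : {x : X // ‖x‖ ≤ 1}, Metric.infDist (T x.1) (L : Set Y) :=
      hc.trans_le (ciInf_le
        (f := fun L : {L : Submodule ℝ Y // Module.finrank ℝ L = n + 1} =>
          ⨆ x : {x : X // ‖x‖ ≤ 1}, Metric.infDist (T x.1) (L.1 : Set Y))
        ⟨0, Set.forall_mem_range.2 fun L => Real.iSup_nonneg fun x => Metric.infDist_nonneg⟩
        ⟨L, hL⟩)
    have : Nonempty {x : X // ‖x‖ ≤ 1} := ⟨⟨0, by simp⟩⟩
    obtain ⟨x, hx⟩ := exists_lt_of_lt_ciSup hlt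
    exact ⟨x.1, x.2, hx⟩

/-- Below the Gelfand width, some point of the unit ball annihilated by the given functionals
has large image. -/
theorem exists_lt_norm_of_lt_gelfandWidthOp (T : X →L[ℝ] Y) {n : ℕ} {c : ℝ}
    (hc : c < gelfandWidthOp T n) (b : Fin n → X →L[ℝ] ℝ) :
    ∃ x : X, ‖x‖ ≤ 1 ∧ (∀ i, b i x = 0) ∧ c < ‖T x‖ := by
  cases n with
  | zero =>
    obtain ⟨x, hx, hcx⟩ := T.exists_lt_apply_of_lt_opNorm hc
    exact ⟨x, hx.le, fun i => i.elim0, hcx⟩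
  | succ n =>
    let B : X →L[ℝ] (Fin (n + 1) → ℝ) := ContinuousLinearMap.pi b
    let e := (B : X →ₗ[ℝ] (Fin (n + 1) → ℝ)).quotKerEquivRange
    let L := LinearMap.ker (B : X →ₗ[ℝ] (Fin (n + 1) → ℝ))
    have hL : IsClosed (L : Set X) ∧ FiniteDimensional ℝ (X ⧸ L) ∧
        Module.finrank ℝ (X ⧸ L) ≤ n + 1 := by
      refine ⟨B.isClosed_ker, e.symm.finiteDimensional, e.finrank_eq.trans_le ?_⟩
      simpa using Submodule.finrank_le (LinearMap.range (B : X →ₗ[ℝ] (Fin (n + 1) → ℝ)))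
    have hlt : c < ⨆ x : {x : X // x ∈ L ∧ ‖x‖ ≤ 1}, ‖T x.1‖ :=
      hc.trans_le (ciInf_le
        (f := fun L : {L : Submodule ℝ X // IsClosed (L : Set X) ∧
            FiniteDimensional ℝ (X ⧸ L) ∧ Module.finrank ℝ (X ⧸ L) ≤ n + 1} =>
          ⨆ x : {x : X // x ∈ L.1 ∧ ‖x‖ ≤ 1}, ‖T x.1‖)
        ⟨0, Set.forall_mem_range.2 fun L => Real.iSup_nonneg fun x => norm_nonneg _⟩ ⟨L, hL⟩)
    have : Nonempty {x : X // x ∈ L ∧ ‖x‖ ≤ 1} := ⟨⟨0, L.zero_mem, by simp⟩⟩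
    obtain ⟨x, hx⟩ := exists_lt_of_lt_ciSup hlt
    exact ⟨x.1, x.2.2, fun i => congrFun (LinearMap.mem_ker.1 x.2.1) i, hx⟩

theorem abs_det_rpow_le_grothOp (T : X →L[ℝ] Y) {n : ℕ}
    (x : Fin n → {x : X // ‖x‖ ≤ 1}) (b : Fin n → {b : Y →L[ℝ] ℝ // ‖b‖ ≤ 1}) :
    |Matrix.det (Matrix.of fun i j => (b j).1 (T (x i).1))| ^ ((1 : ℝ) / n) ≤ grothOp T n := by
  refine le_ciSup (f := fun p : (Fin n → {x : X // ‖x‖ ≤ 1}) ×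
      (Fin n → {b : Y →L[ℝ] ℝ // ‖b‖ ≤ 1}) =>
    |Matrix.det (Matrix.of fun i j => (p.2 j).1 (T (p.1 i).1))| ^ ((1 : ℝ) / n))
    ⟨(n.factorial • ‖T‖ ^ n) ^ ((1 : ℝ) / n), ?_⟩ (x, b)
  rintro _ ⟨p, rfl⟩
  refine Real.rpow_le_rpow (abs_nonneg _) ?_ (by positivity)
  have h := Matrix.det_le (abv := AbsoluteValue.abs) (x := ‖T‖)
    (A := Matrix.of fun i j => (p.2 j).1 (T (p.1 i).1)) fun i j => ?_
  · simpa using h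
  · have hT : ‖T (p.1 i).1‖ ≤ ‖T‖ := by simpa using T.le_of_opNorm_le_of_le le_rfl (p.1 i).2
    simpa using (p.2 j).1.le_of_opNorm_le_of_le (p.2 j).2 hT

theorem grothOp_nonneg (T : X →L[ℝ] Y) (n : ℕ) : 0 ≤ grothOp T n :=
  Real.iSup_nonneg fun _ => by positivity

/-- The bound on the geometric mean of `d` follows from bounds for the positive sequences
strictly below it. -/
theorem prod_rpow_le_of_forall_lt {d : ℕ → ℝ} (hd : ∀ k, 0 ≤ d k) {n : ℕ} (hn : 1 ≤ n) {G : ℝ}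
    (hG : 0 ≤ G)
    (h : ∀ c : ℕ → ℝ, (∀ k < n, 0 < c k ∧ c k < d k) →
      (∏ k ∈ Finset.range n, c k) ^ ((1 : ℝ) / n) ≤ G) :
    (∏ k ∈ Finset.range n, d k) ^ ((1 : ℝ) / n) ≤ G := by
  by_cases h0 : ∃ k < n, d k = 0
  · obtain ⟨k, hk, hdk⟩ := h0
    rw [Finset.prod_eq_zero (Finset.mem_range.2 hk) hdk, Real.zero_rpow (by positivity)]
    exact hG
  · push Not at h0
    have hcont : Continuous fun t : ℝ =>
        (∏ k ∈ Finset.range n, t * d k) ^ ((1 : ℝ) / n) :=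
      (continuous_finsetProd _ fun k _ => by fun_prop).rpow_const fun _ => Or.inr (by positivity)
    have hlim := (hcont.tendsto 1).mono_left (nhdsWithin_le_nhds (s := Set.Iio 1))
    simp only [one_mul] at hlim
    refine le_of_tendsto hlim ?_
    filter_upwards [Ioo_mem_nhdsLT (zero_lt_one (α := ℝ))] with t ht
    refine h _ fun k hk => ?_
    have hpos : 0 < d k := (hd k).lt_of_ne' (h0 k hk)
    exact ⟨mul_pos ht.1 hpos, mul_lt_of_lt_one_left hpos ht.2⟩

theorem kolWidthOp_prod_rpow_le_grothOp (T : X →L[ℝ] Y) {n : ℕ} (hn : 1 ≤ n) :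
    (∏ k ∈ Finset.range n, kolWidthOp T k) ^ ((1 : ℝ) / n) ≤ grothOp T n := by
  refine prod_rpow_le_of_forall_lt (kolWidthOp_nonneg T) hn (grothOp_nonneg T n) fun c hc => ?_
  have : Nonempty ({x : X // ‖x‖ ≤ 1} × {b : Y →L[ℝ] ℝ // ‖b‖ ≤ 1}) :=
    ⟨⟨0, by simp⟩, ⟨0, by simp⟩⟩
  have hdet (f : ℕ → {x : X // ‖x‖ ≤ 1} × {b : Y →L[ℝ] ℝ // ‖b‖ ≤ 1}) (k : ℕ)
      (hf : ∀ i < k, ∀ j < i, (f i).2.1 (T (f j).1.1) = 0) :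
      Matrix.det (Matrix.of fun i j : Fin k => (f j).2.1 (T (f i).1.1)) =
        ∏ i : Fin k, (f i).2.1 (T (f i).1.1) :=
    Matrix.det_of_isLowerTriangular _ fun i j hij => hf j j.2 i hij
  obtain ⟨f, hf⟩ := exists_seq_of_extend
    (fun k (p : {x : X // ‖x‖ ≤ 1} × {b : Y →L[ℝ] ℝ // ‖b‖ ≤ 1}) => c k < p.2.1 (T p.1.1))
    (fun p q => q.2.1 (T p.1.1) = 0) n fun k hk f hf => by
      have hne : Matrix.det (Matrix.of fun i j : Fin k => (f j).2.1 (T (f i).1.1)) ≠ 0 := by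
        rw [hdet f k fun i hi => (hf i hi).2]
        exact Finset.prod_ne_zero_iff.2 fun i _ =>
          ((hc i (i.2.trans hk)).1.trans (hf i i.2).1).ne'
      have hli : LinearIndependent ℝ fun i : Fin k => T (f i).1.1 :=
        LinearIndependent.of_comp (LinearMap.pi fun j : Fin k => ((f j).2.1 : Y →ₗ[ℝ] ℝ))
          (Matrix.linearIndependent_rows_of_det_ne_zero hne)
      have : FiniteDimensional ℝ (Submodule.span ℝ (Set.range fun i : Fin k => T (f i).1.1)) :=
        FiniteDimensional.span_of_finite ℝ (Set.finite_range _)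
      obtain ⟨x, hx, hcx⟩ := exists_lt_infDist_of_lt_kolWidthOp T (hc k hk).2 _
        ((finrank_span_eq_card hli).trans (Fintype.card_fin k))
      obtain ⟨b, hb, hbL, hbx⟩ := exists_dual_eq_infDist
        (Submodule.span ℝ (Set.range fun i : Fin k => T (f i).1.1)) (T x)
      exact ⟨(⟨x, hx⟩, ⟨b, hb⟩), hcx.trans_eq hbx.symm,
        fun i hi => hbL _ (Submodule.subset_span ⟨⟨i, hi⟩, rfl⟩)⟩
  refine le_trans ?_ (abs_det_rpow_le_grothOp T (fun i => (f i).1) fun i => (f i).2)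
  rw [hdet f n fun i hi => (hf i hi).2, ← Fin.prod_univ_eq_prod_range]
  refine Real.rpow_le_rpow (Finset.prod_nonneg fun (i : Fin n) _ => (hc i i.2).1.le) ?_ (by positivity)
  exact (Finset.prod_le_prod (fun (i : Fin n) _ => (hc i i.2).1.le)
    fun i _ => (hf i i.2).1.le).trans (le_abs_self _)

theorem gelfandWidthOp_prod_rpow_le_grothOp (T : X →L[ℝ] Y) {n : ℕ} (hn : 1 ≤ n) :
    (∏ k ∈ Finset.range n, gelfandWidthOp T k) ^ ((1 : ℝ) / n) ≤ grothOp T n := by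
  refine prod_rpow_le_of_forall_lt (gelfandWidthOp_nonneg T) hn (grothOp_nonneg T n)
    fun c hc => ?_
  have : Nonempty ({x : X // ‖x‖ ≤ 1} × {b : Y →L[ℝ] ℝ // ‖b‖ ≤ 1}) :=
    ⟨⟨0, by simp⟩, ⟨0, by simp⟩⟩
  obtain ⟨f, hf⟩ := exists_seq_of_extend
    (fun k (p : {x : X // ‖x‖ ≤ 1} × {b : Y →L[ℝ] ℝ // ‖b‖ ≤ 1}) => c k < p.2.1 (T p.1.1))
    (fun p q => p.2.1 (T q.1.1) = 0) n fun k hk f _ => by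
      obtain ⟨x, hx, hbx, hcx⟩ := exists_lt_norm_of_lt_gelfandWidthOp T (hc k hk).2
        fun i : Fin k => (f i).2.1.comp T
      obtain ⟨b, hb, hbTx⟩ := exists_dual_vector'' ℝ (T x)
      exact ⟨(⟨x, hx⟩, ⟨b, hb⟩), hcx.trans_eq hbTx.symm, fun i hi => hbx ⟨i, hi⟩⟩
  refine le_trans ?_ (abs_det_rpow_le_grothOp T (fun i => (f i).1) fun i => (f i).2)
  have hdet : Matrix.det (Matrix.of fun i j : Fin n => (f j).2.1 (T (f i).1.1)) =
      ∏ i : Fin n, (f i).2.1 (T (f i).1.1) :=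
    Matrix.det_of_isUpperTriangular fun i j hij => (hf i i.2).2 j hij
  rw [hdet, ← Fin.prod_univ_eq_prod_range]
  refine Real.rpow_le_rpow (Finset.prod_nonneg fun (i : Fin n) _ => (hc i i.2).1.le) ?_ (by positivity)
  exact (Finset.prod_le_prod (fun (i : Fin n) _ => (hc i i.2).1.le)
    fun i _ => (hf i i.2).1.le).trans (le_abs_self _)

end Widths

theorem widths_geometric_mean_le_groth
    {X Y : Type*} [NormedAddCommGroup X] [NormedSpace ℝ X] [CompleteSpace X]
    [NormedAddCommGroup Y] [NormedSpace ℝ Y] [CompleteSpace Y]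
    (T : X →L[ℝ] Y) :
    ∀ n : ℕ, 1 ≤ n →
      (∏ k ∈ Finset.range n, kolWidthOp T k) ^ ((1 : ℝ) / n) ≤ grothOp T n ∧
      (∏ k ∈ Finset.range n, gelfandWidthOp T k) ^ ((1 : ℝ) / n) ≤ grothOp T n := by
  exact fun n hn => ⟨kolWidthOp_prod_rpow_le_grothOp T hn,
    gelfandWidthOp_prod_rpow_le_grothOp T hn⟩
end

section
/- Let 2 < q < ∞ and α > 1/2 − 1/q, and let K = {n^{−α}·u_n : n ≥ 1} ∪ {0} ⊂ ℓ_q, where (u_n)_{n≥1} is the canonical unit vector basis of ℓ_q. Then there exists a constant C > 0 such that for every greedy sequence for K and every n ≥ 1, σ_{3n−1}(K)_{ℓ_q} ≤ C·n^{−α}. In particular the greedy algorithm achieves the exact decay rate n^{−α} for this set K. -/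
open scoped BigOperators NNReal ENNReal

theorem greedySpan_mono_s14 {X : Type*} [NormedAddCommGroup X] [NormedSpace ℝ X]
    (f : ℕ → X) : Monotone (greedySpan f) :=
  fun _ _ h => Submodule.span_mono (Set.image_mono (Set.Iio_subset_Iio h))

theorem greedyErr_le_norm {X : Type*} [NormedAddCommGroup X] [NormedSpace ℝ X]
    (f : ℕ → X) (n : ℕ) : greedyErr f n ≤ ‖f n‖ := by
  simpa [greedyErr] using Metric.infDist_le_dist_of_mem (x := f n) (greedySpan f n).zero_mem

theorem greedyErr_eq_zero_of_eq {X : Type*} [NormedAddCommGroup X] [NormedSpace ℝ X]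
    {f : ℕ → X} {j k : ℕ} (hjk : j < k) (h : f j = f k) : greedyErr f k = 0 := by
  refine Metric.infDist_zero_of_mem ?_
  rw [← h]
  exact Submodule.subset_span ⟨j, hjk, rfl⟩

theorem IsGreedySeq.antitone_greedyErr {X : Type*} [NormedAddCommGroup X] [NormedSpace ℝ X]
    {K : Set X} {f : ℕ → X} (hf : IsGreedySeq K f) : Antitone (greedyErr f) :=
  fun j k hjk => (Metric.infDist_le_infDist_of_subset (greedySpan_mono_s14 f hjk)
    ⟨0, (greedySpan f j).zero_mem⟩).trans ((hf j).2 _ (hf k).1)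

/-- If the elements of `K` of norm greater than `r` are among `g 0, …, g (n - 1)`, then the greedy
errors are at most `r` from index `n` on. -/
theorem IsGreedySeq.greedyErr_le_s14 {X : Type*} [NormedAddCommGroup X] [NormedSpace ℝ X]
    {K : Set X} {f : ℕ → X} (hf : IsGreedySeq K f) {r : ℝ} (hr : 0 ≤ r) (g : ℕ → X) {n N : ℕ}
    (hnN : n ≤ N) (hK : ∀ x ∈ K, r < ‖x‖ → ∃ m < n, x = g m) : greedyErr f N ≤ r := by
  by_contra! hN
  have hlt : ∀ k ≤ N, r < greedyErr f k := fun k hk => hN.trans_le (hf.antitone_greedyErr hk)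
  have hex : ∀ k, ∃ m, k ≤ N → m < n ∧ f k = g m := fun k => by
    by_cases hk : k ≤ N
    · obtain ⟨m, hm⟩ := hK _ (hf k).1 ((hlt k hk).trans_le (greedyErr_le_norm f k))
      exact ⟨m, fun _ => hm⟩
    · exact ⟨0, fun h => absurd h hk⟩
  choose m hm using hex
  obtain ⟨j, hj, k, hk, hne, heq⟩ := Finset.exists_ne_map_eq_of_card_lt_of_maps_to
    (s := Finset.range (N + 1)) (t := Finset.range n) (f := m) (by simp; omega)
    (fun k hk => by
      have hk' : k ≤ N := by simpa [Nat.lt_succ_iff] using hk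
      simpa using (hm k hk').1)
  rw [Finset.mem_range, Nat.lt_succ_iff] at hj hk
  have hfeq : f j = f k := by rw [(hm j hj).2, (hm k hk).2, heq]
  rcases lt_or_gt_of_ne hne with h | h
  · exact ((hlt k hk).trans_le (greedyErr_eq_zero_of_eq h hfeq).le).not_ge hr
  · exact ((hlt j hj).trans_le (greedyErr_eq_zero_of_eq h hfeq.symm).le).not_ge hr

theorem greedy_rate_of_diagonal_example
    (q : ℝ≥0∞) [Fact (1 ≤ q)] (hq2 : 2 < q) (hqtop : q < ⊤)
    (α : ℝ) (hα : 1 / 2 - q.toReal⁻¹ < α)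
    (K : Set (lp (fun _ : ℕ => ℝ) q))
    (hK : K = {x | ∃ n : ℕ, 1 ≤ n ∧ x = ((n : ℝ) ^ (-α)) • lp.single q n 1} ∪ {0}) :
    ∃ C : ℝ, 0 < C ∧
      ∀ f : ℕ → lp (fun _ : ℕ => ℝ) q, IsGreedySeq K f →
        ∀ n : ℕ, 1 ≤ n → greedyErr f (3 * n - 1) ≤ C * (n : ℝ) ^ (-α) := by
  have hq : 2 < q.toReal := by
    simpa using (ENNReal.toReal_lt_toReal (by simp) hqtop.ne).2 hq2
  have hα0 : 0 < α := by
    have : q.toReal⁻¹ < 2⁻¹ := by gcongr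
    linarith
  refine ⟨1, one_pos, fun f hf n hn => ?_⟩
  rw [one_mul]
  refine hf.greedyErr_le_s14 (by positivity)
    (fun m => ((m : ℝ) ^ (-α)) • lp.single q m 1) (n := n) (by omega) fun x hx hnx => ?_
  rw [hK] at hx
  rcases hx with ⟨m, hm, rfl⟩ | rfl
  · refine ⟨m, ?_, rfl⟩
    rw [norm_smul, lp.norm_single (zero_lt_two.trans hq2), norm_one, mul_one,
      Real.norm_of_nonneg (by positivity),
      Real.rpow_lt_rpow_iff_of_neg (by positivity) (by positivity) (by linarith)] at hnx
    exact_mod_cast hnx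
  · rw [norm_zero] at hnx
    exact absurd hnx (not_lt.2 (by positivity))
end
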